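/- Let X^r, Y^r, Z^r denote the frames X, Y, Z with R replaced by its reflexive closure, and let f : X^r → Z^r, g : Y^r → Z^r be the maps f and g (which are surjective FS-morphisms between these reflexive frames). Then there exist no FS-frame W and surjective FS-morphisms p₁ : W → X^r and p₂ : W → Y^r such that f ∘ p₁ = g ∘ p₂. -/

import Mathlib

/-- An FS-frame: a poset (le) with a binary relation R satisfying the
Fischer-Servi confluence conditions F1 and F2. -/
structure IsFSFrame {α : Type*} (le R : α → α → Prop) : Prop where
  refl : ∀ a, le a a
  trans : ∀ a b c, le a b → le b c → le a c
  antisymm : ∀ a b, le a b → le b a → a = b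
  F1 : ∀ x x' y, le x x' → R x y → ∃ y', R x' y' ∧ le y y'
  F2 : ∀ x y y', R x y → le y y' → ∃ x', le x x' ∧ R x' y'

/-- An FS-morphism between FS-frames. -/
structure IsFSMorphism {α β : Type*} (leX RX : α → α → Prop)
    (leY RY : β → β → Prop) (f : α → β) : Prop where
  mono : ∀ a b, leX a b → leY (f a) (f b)
  le_back : ∀ a z, leY (f a) z → ∃ a', leX a a' ∧ f a' = z
  forth : ∀ a b, RX a b → RY (f a) (f b)
  weak_back : ∀ a z, RY (f a) z → ∃ a', RX a a' ∧ leY z (f a')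
  strong_back : ∀ a m z, leY (f a) m → RY m z →
    ∃ a' a'', leX a a' ∧ RX a' a'' ∧ leY (f a'') z


/-- The underlying set of the frame X. -/
inductive XF : Type
  | x0 | x1 | x2 | a0 | a1 | a2 | a3 | a4
deriving DecidableEq

/-- The partial order on X generated by x0 ≤ x2, x0 ≤ a3, x0 ≤ a4, x1 ≤ a0,
x1 ≤ a2, together with reflexivity (transitivity adds nothing new). -/
def Xle : XF → XF → Prop := fun a b => a = b ∨
  (a = .x0 ∧ (b = .x2 ∨ b = .a3 ∨ b = .a4)) ∨
  (a = .x1 ∧ (b = .a0 ∨ b = .a2))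

/-- The relation R on X. -/
def XR : XF → XF → Prop := fun a b =>
  (a = .x0 ∧ b = .x1) ∨ (a = .x2 ∧ b = .a0) ∨ (a = .x2 ∧ b = .a1) ∨
  (a = .a3 ∧ b = .a0) ∨ (a = .a4 ∧ b = .a2)

/-- The underlying set of the frame Y. -/
inductive YF : Type
  | y0 | y1 | y2 | b0 | b1 | b2 | b3 | b4
deriving DecidableEq

/-- The partial order on Y generated by y0 ≤ y2, y0 ≤ b3, y0 ≤ b4, y1 ≤ b0,
y1 ≤ b2, together with reflexivity. -/
def Yle : YF → YF → Prop := fun a b => a = b ∨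
  (a = .y0 ∧ (b = .y2 ∨ b = .b3 ∨ b = .b4)) ∨
  (a = .y1 ∧ (b = .b0 ∨ b = .b2))

/-- The relation R on Y. -/
def YR : YF → YF → Prop := fun a b =>
  (a = .y0 ∧ b = .y1) ∨ (a = .y2 ∧ b = .b1) ∨ (a = .y2 ∧ b = .b2) ∨
  (a = .b3 ∧ b = .b0) ∨ (a = .b4 ∧ b = .b2)

/-- The underlying set of the frame Z. -/
inductive ZF : Type
  | z0 | z1 | z2 | k0 | k2 | k3 | k4
deriving DecidableEq

/-- The partial order on Z generated by z0 ≤ z2, z0 ≤ k3, z0 ≤ k4, z1 ≤ k0,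
z1 ≤ k2, together with reflexivity. -/
def Zle : ZF → ZF → Prop := fun a b => a = b ∨
  (a = .z0 ∧ (b = .z2 ∨ b = .k3 ∨ b = .k4)) ∨
  (a = .z1 ∧ (b = .k0 ∨ b = .k2))

/-- The relation R on Z. -/
def ZR : ZF → ZF → Prop := fun a b =>
  (a = .z0 ∧ b = .z1) ∨ (a = .z2 ∧ b = .k0) ∨ (a = .z2 ∧ b = .k2) ∨
  (a = .k3 ∧ b = .k0) ∨ (a = .k4 ∧ b = .k2)

/-- The map f : X → Z. -/
def fXZ : XF → ZF
  | .x0 => .z0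
  | .x1 => .z1
  | .x2 => .z2
  | .a0 => .k0
  | .a1 => .k2
  | .a2 => .k2
  | .a3 => .k3
  | .a4 => .k4

/-- The map g : Y → Z. -/
def gYZ : YF → ZF
  | .y0 => .z0
  | .y1 => .z1
  | .y2 => .z2
  | .b0 => .k0
  | .b1 => .k0
  | .b2 => .k2
  | .b3 => .k3
  | .b4 => .k4


/-- The reflexive closure of a relation. -/
def reflCl {α : Type*} (R : α → α → Prop) : α → α → Prop :=
  fun a b => R a b ∨ a = b

/-- the co-V-formation of the reflexive frames Xʳ, Yʳ, Zʳ
(obtained by replacing R with its reflexive closure) along the maps f and g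
has no co-amalgam: there are no FS-frame W and surjective FS-morphisms
p₁ : W → Xʳ and p₂ : W → Yʳ with f ∘ p₁ = g ∘ p₂. -/
theorem no_coamalgam_reflexive :
    ∀ (W : Type u) (leW RW : W → W → Prop) (p₁ : W → XF) (p₂ : W → YF),
      IsFSFrame leW RW →
      IsFSMorphism leW RW Xle (reflCl XR) p₁ →
      IsFSMorphism leW RW Yle (reflCl YR) p₂ →
      Function.Surjective p₁ → Function.Surjective p₂ →
      fXZ ∘ p₁ = gYZ ∘ p₂ → False := by
  intro W leW RW p₁ p₂ hW h₁ h₂ hs₁ _ hfg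
  have hfg' : ∀ w, fXZ (p₁ w) = gYZ (p₂ w) := congrFun hfg
  obtain ⟨w, hw⟩ := hs₁ .x0
  obtain ⟨w', hww', hx₁⟩ := h₁.weak_back w .x1 (by simp [hw, reflCl, XR])
  obtain ⟨u, hwu, hu⟩ := h₁.le_back w .x2 (by simp [hw, Xle])
  obtain ⟨v, huv, hw'v⟩ := hW.F1 w u w' hwu hww'
  have hw' : p₁ w' = .x1 := by
    have h := h₁.forth _ _ hww'
    rw [hw] at h
    cases hc : p₁ w' <;> simp_all [reflCl, XR, Xle]
  have hv : p₁ v = .a0 := by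
    have h := h₁.forth _ _ huv
    have h' := h₁.mono _ _ hw'v
    rw [hu] at h
    rw [hw'] at h'
    cases hc : p₁ v <;> simp_all [reflCl, XR, Xle]
  have hw'₂ : p₂ w' = .y1 := by
    have h := hfg' w'
    rw [hw'] at h
    cases hc : p₂ w' <;> simp_all [fXZ, gYZ]
  have hu₂ : p₂ u = .y2 := by
    have h := hfg' u
    rw [hu] at h
    cases hc : p₂ u <;> simp_all [fXZ, gYZ]
  have h := h₂.forth _ _ huv
  have h' := h₂.mono _ _ hw'v
  have hk := hfg' v
  rw [hu₂] at h
  rw [hw'₂] at h'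
  rw [hv] at hk
  cases hc : p₂ v <;> simp_all [reflCl, YR, Yle, fXZ, gYZ]
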